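/- The Nambu–Lie 3-algebra 𝒜₄ admits no nontrivial representation by Hermitian matrices with scalar T₄: if T₁,T₂,T₃,T₄ are Hermitian n×n complex matrices forming a matrix representation of 𝒜₄ and T₄ = t·I is a scalar matrix (so t is real), then T₁ = T₂ = T₃ = T₄ = 0. -/

import Mathlib

/-- The Nambu commutator of three square complex matrices:
`[A,B,C]_N = ABC + BCA + CAB − BAC − ACB − CBA`. -/
noncomputable def nambu {n : ℕ} (A B C : Matrix (Fin n) (Fin n) ℂ) :
    Matrix (Fin n) (Fin n) ℂ :=
  A * B * C + B * C * A + C * A * B - B * A * C - A * C * B - C * B * A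

/-- The totally antisymmetric tensor `ε_{abcd}` on four indices with
`ε_{1234} = +1` (indices `1,2,3,4` are represented by `0,1,2,3 : Fin 4`). -/
def eps4 (a b c d : Fin 4) : ℤ :=
  ∑ σ : Equiv.Perm (Fin 4),
    if σ 0 = a ∧ σ 1 = b ∧ σ 2 = c ∧ σ 3 = d then (Equiv.Perm.sign σ : ℤ) else 0

/-- With a scalar third entry the Nambu commutator is a multiple of the commutator. -/
theorem nambu_smul_one {n : ℕ} (A B : Matrix (Fin n) (Fin n) ℂ) (t : ℂ) :
    nambu A B (t • 1) = t • (A * B - B * A) := by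
  simp only [nambu, mul_smul_comm, smul_mul_assoc, mul_one, one_mul, smul_sub]
  abel

/-- The Nambu commutator expanded in terms of ordinary commutators. -/
theorem nambu_eq_mul_commutator {n : ℕ} (A B C : Matrix (Fin n) (Fin n) ℂ) :
    nambu A B C = A * (B * C - C * B) + B * (C * A - A * C) + C * (A * B - B * A) := by
  simp only [nambu]
  noncomm_ring

open scoped ComplexOrder Matrix in
/-- Hermitian matrices whose squares sum to zero all vanish. -/
theorem Matrix.IsHermitian.eq_zero_of_sum_mul_self_eq_zero {ι : Type*} [Fintype ι] {n : ℕ}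
    {T : ι → Matrix (Fin n) (Fin n) ℂ} (hT : ∀ a, (T a).IsHermitian)
    (hsum : ∑ a, T a * T a = 0) (a : ι) : T a = 0 := by
  have hnonneg : ∀ b ∈ Finset.univ, 0 ≤ ((T b)ᴴ * T b).trace := fun b _ =>
    (Matrix.posSemidef_conjTranspose_mul_self (T b)).trace_nonneg
  have htrace : ∑ b, ((T b)ᴴ * T b).trace = 0 := by
    rw [← Matrix.trace_sum]
    simp only [(hT _).eq, hsum, Matrix.trace_zero]
  exact Matrix.trace_conjTranspose_mul_self_eq_zero_iff.mp
    ((Finset.sum_eq_zero_iff_of_nonneg hnonneg).mp htrace a (Finset.mem_univ a))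

/-- `𝒜₄` admits no nontrivial representation by Hermitian matrices with scalar
`T₄`: if `T₁,T₂,T₃,T₄` are Hermitian matrices forming a representation of `𝒜₄`
and `T₄ = t·I` with `t` real, then all the `T_a` vanish. -/
theorem A4_no_hermitian_rep_scalar_T4 (n : ℕ)
    (T : Fin 4 → Matrix (Fin n) (Fin n) ℂ)
    (hherm : ∀ a : Fin 4, (T a).IsHermitian)
    (hrep : ∀ a b c : Fin 4,
      nambu (T a) (T b) (T c) = Complex.I • ∑ d, (eps4 a b c d : ℂ) • T d)
    (t : ℝ)
    (hT4 : T 3 = (t : ℂ) • 1) :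
    ∀ a : Fin 4, T a = 0 := by
  have e012 : ∀ d, eps4 0 1 2 d = if d = 3 then 1 else 0 := by decide
  have e013 : ∀ d, eps4 0 1 3 d = if d = 2 then -1 else 0 := by decide
  have e203 : ∀ d, eps4 2 0 3 d = if d = 1 then -1 else 0 := by decide
  have e123 : ∀ d, eps4 1 2 3 d = if d = 0 then -1 else 0 := by decide
  have h012 : nambu (T 0) (T 1) (T 2) = Complex.I • T 3 := by
    simp [hrep, e012]
  have h01 : (t : ℂ) • (T 0 * T 1 - T 1 * T 0) = -(Complex.I • T 2) := by
    rw [← nambu_smul_one, ← hT4, hrep]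
    simp [e013]
  have h20 : (t : ℂ) • (T 2 * T 0 - T 0 * T 2) = -(Complex.I • T 1) := by
    rw [← nambu_smul_one, ← hT4, hrep]
    simp [e203]
  have h12 : (t : ℂ) • (T 1 * T 2 - T 2 * T 1) = -(Complex.I • T 0) := by
    rw [← nambu_smul_one, ← hT4, hrep]
    simp [e123]
  have h33 : T 3 * T 3 = (t : ℂ) • T 3 := by
    nth_rewrite 1 [hT4]
    rw [smul_mul_assoc, one_mul]
  have key : Complex.I • (T 3 * T 3) =
      -(Complex.I • (T 0 * T 0 + T 1 * T 1 + T 2 * T 2)) := by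
    rw [h33, smul_comm, ← h012, nambu_eq_mul_commutator, smul_add, smul_add,
      ← mul_smul_comm, ← mul_smul_comm, ← mul_smul_comm, h01, h20, h12]
    simp only [mul_neg, mul_smul_comm, smul_add]
    abel
  refine Matrix.IsHermitian.eq_zero_of_sum_mul_self_eq_zero hherm ?_
  rw [Fin.sum_univ_four]
  rw [← smul_neg] at key
  rw [smul_right_injective _ Complex.I_ne_zero key, add_neg_cancel]
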